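/- Let D, Y, X be finite nonempty types and Z := D × (D → Y) × X, and let ≿ be a binary relation on lotteries on Z. The following are equivalent: (1) ≿ satisfies Completeness, Transitivity, Independence, Continuity, and Realized Outcome Sufficiency; (2) there exists a function u : Y → ℝ such that the outcome utility ũ(d, y, x) := u(y d) represents ≿. Moreover, any two such representing functions u, u' are related by a positive affine transformation: there exist a > 0 and b ∈ ℝ with u' = a·u + b. -/

import Mathlib

/-- `p` is a lottery on the finite type `Z`. -/
def IsLottery {Z : Type*} [Fintype Z] (p : Z → ℝ) : Prop :=
  (∀ z, 0 ≤ p z) ∧ ∑ z, p z = 1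

/-- Expected utility of lottery `p` under utility `u`. -/
noncomputable def expUtil {Z : Type*} [Fintype Z] (u p : Z → ℝ) : ℝ :=
  ∑ z, u z * p z

/-- Mixture `α p + (1 - α) q`. -/
def mix {Z : Type*} (α : ℝ) (p q : Z → ℝ) : Z → ℝ :=
  fun z => α * p z + (1 - α) * q z

/-- `u` represents the relation `R` on lotteries. -/
def Represents {Z : Type*} [Fintype Z]
    (R : (Z → ℝ) → (Z → ℝ) → Prop) (u : Z → ℝ) : Prop :=
  ∀ p q : Z → ℝ, IsLottery p → IsLottery q → (R p q ↔ expUtil u p ≥ expUtil u q)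

/-- Strict preference `p ≻ q`. -/
def StrictPref {Z : Type*} (R : (Z → ℝ) → (Z → ℝ) → Prop) (p q : Z → ℝ) : Prop :=
  R p q ∧ ¬ R q p

/-- Completeness on lotteries. -/
def CompleteAx {Z : Type*} [Fintype Z] (R : (Z → ℝ) → (Z → ℝ) → Prop) : Prop :=
  ∀ p q : Z → ℝ, IsLottery p → IsLottery q → (R p q ∨ R q p)

/-- Transitivity on lotteries. -/
def TransitiveAx {Z : Type*} [Fintype Z] (R : (Z → ℝ) → (Z → ℝ) → Prop) : Prop :=
  ∀ p q r : Z → ℝ, IsLottery p → IsLottery q → IsLottery r → R p q → R q r → R p r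

/-- vNM Independence on lotteries. -/
def IndependenceAx {Z : Type*} [Fintype Z] (R : (Z → ℝ) → (Z → ℝ) → Prop) : Prop :=
  ∀ p q r : Z → ℝ, IsLottery p → IsLottery q → IsLottery r →
    ∀ α : ℝ, 0 < α → α ≤ 1 →
      StrictPref R p q → StrictPref R (mix α p r) (mix α q r)

/-- vNM Continuity on lotteries. -/
def ContinuityAx {Z : Type*} [Fintype Z] (R : (Z → ℝ) → (Z → ℝ) → Prop) : Prop :=
  ∀ p q r : Z → ℝ, IsLottery p → IsLottery q → IsLottery r →
    StrictPref R p q → StrictPref R q r →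
      ∃ α β : ℝ, 0 < α ∧ α < 1 ∧ 0 < β ∧ β < 1 ∧
        StrictPref R (mix α p r) q ∧ StrictPref R q (mix β p r)

section PotentialOutcomeSpace

variable {D Y X : Type*} [Fintype D] [DecidableEq D] [Fintype Y] [DecidableEq Y]
  [Fintype X] [DecidableEq X]

/-- Probability that the decision equals `d` under lottery `p` on `D × (D → Y) × X`. -/
noncomputable def probDec (p : D × (D → Y) × X → ℝ) (d : D) : ℝ :=
  ∑ z, if z.1 = d then p z else 0

/-- Probability that the covariate equals `x` under lottery `p`. -/
noncomputable def probCov (p : D × (D → Y) × X → ℝ) (x : X) : ℝ :=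
  ∑ z, if z.2.2 = x then p z else 0

/-- Probability that the potential outcome coordinate `y k` equals `v` under `p`. -/
noncomputable def probOut (p : D × (D → Y) × X → ℝ) (k : D) (v : Y) : ℝ :=
  ∑ z, if z.2.1 k = v then p z else 0

end PotentialOutcomeSpace

section Stmt3

variable {D Y X : Type*} [Fintype D] [DecidableEq D] [Fintype Y] [DecidableEq Y]
  [Fintype X] [DecidableEq X]

/-- Realized Outcome Sufficiency. -/
def RealizedOutcomeSufficiency
    (R : (D × (D → Y) × X → ℝ) → (D × (D → Y) × X → ℝ) → Prop) : Prop :=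
  ∀ p q : D × (D → Y) × X → ℝ, IsLottery p → IsLottery q →
    ∀ (d d' : D) (x x' : X),
      probDec p d = 1 → probCov p x = 1 →
      probDec q d' = 1 → probCov q x' = 1 →
      (∀ v : Y, probOut p d v = probOut q d' v) →
      (R p q ∧ R q p)

end Stmt3

section Lottery

variable {Z : Type*} [Fintype Z]

theorem IsLottery.mix {p q : Z → ℝ} (hp : IsLottery p) (hq : IsLottery q) {α : ℝ}
    (h0 : 0 ≤ α) (h1 : α ≤ 1) : IsLottery (mix α p q) := by
  refine ⟨fun z => add_nonneg (mul_nonneg h0 (hp.1 z))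
    (mul_nonneg (sub_nonneg.2 h1) (hq.1 z)), ?_⟩
  simp only [_root_.mix, Finset.sum_add_distrib, ← Finset.mul_sum, hp.2, hq.2]
  ring

theorem IsLottery.single [DecidableEq Z] (z : Z) : IsLottery (Pi.single z (1 : ℝ)) := by
  refine ⟨fun w => ?_, by simp⟩
  by_cases h : w = z <;> simp [h]

theorem IsLottery.sum_smul {ι : Type*} [Fintype ι] {p : ι → ℝ} (hp : IsLottery p)
    {f : ι → Z → ℝ} (hf : ∀ i, IsLottery (f i)) : IsLottery (∑ i, p i • f i) := by
  refine ⟨fun z => ?_, ?_⟩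
  · rw [Finset.sum_apply]
    exact Finset.sum_nonneg fun i _ => mul_nonneg (hp.1 i) ((hf i).1 z)
  · simp only [Finset.sum_apply, Pi.smul_apply, smul_eq_mul]
    rw [Finset.sum_comm]
    simp only [← Finset.mul_sum, (hf _).2, mul_one, hp.2]

theorem expUtil_mix (u p q : Z → ℝ) (α : ℝ) :
    expUtil u (mix α p q) = α * expUtil u p + (1 - α) * expUtil u q := by
  simp only [expUtil, mix, Finset.mul_sum, ← Finset.sum_add_distrib]
  exact Finset.sum_congr rfl fun z _ => by ring

theorem expUtil_single [DecidableEq Z] (u : Z → ℝ) (z : Z) :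
    expUtil u (Pi.single z 1) = u z := by
  simp [expUtil, Pi.single_apply]

end Lottery

section Representation

variable {Z : Type*} [Fintype Z] {R : (Z → ℝ) → (Z → ℝ) → Prop} {u : Z → ℝ}

theorem Represents.strictPref_iff (h : Represents R u) {p q : Z → ℝ}
    (hp : IsLottery p) (hq : IsLottery q) :
    StrictPref R p q ↔ expUtil u q < expUtil u p := by
  rw [StrictPref, h p q hp hq, h q p hq hp, ge_iff_le, ge_iff_le, not_le]
  exact ⟨fun h => h.2, fun h => ⟨h.le, h⟩⟩

theorem Represents.completeAx (h : Represents R u) : CompleteAx R := by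
  intro p q hp hq
  rw [h p q hp hq, h q p hq hp]
  exact le_total _ _

theorem Represents.transitiveAx (h : Represents R u) : TransitiveAx R := by
  intro p q r hp hq hr
  rw [h p q hp hq, h q r hq hr, h p r hp hr]
  exact fun h₁ h₂ => h₂.trans h₁

theorem Represents.independenceAx (h : Represents R u) : IndependenceAx R := by
  intro p q r hp hq hr α h0 h1
  rw [h.strictPref_iff hp hq, h.strictPref_iff (hp.mix hr h0.le h1) (hq.mix hr h0.le h1),
    expUtil_mix, expUtil_mix]
  intro hlt
  gcongr

theorem Represents.continuityAx (h : Represents R u) : ContinuityAx R := by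
  intro p q r hp hq hr hpq hqr
  rw [h.strictPref_iff hp hq] at hpq
  rw [h.strictPref_iff hq hr] at hqr
  obtain ⟨t, ht⟩ : ∃ t, t = (expUtil u q - expUtil u r) / (expUtil u p - expUtil u r) :=
    ⟨_, rfl⟩
  have hpos : 0 < expUtil u p - expUtil u r := by linarith
  have ht0 : 0 < t := ht ▸ div_pos (by linarith) hpos
  have ht1 : t < 1 := by rw [ht, div_lt_one hpos]; linarith
  have hmul : t * (expUtil u p - expUtil u r) = expUtil u q - expUtil u r := by
    rw [ht]; field_simp
  refine ⟨(1 + t) / 2, t / 2, by linarith, by linarith, by linarith, by linarith, ?_, ?_⟩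
  · rw [h.strictPref_iff (hp.mix hr (by linarith) (by linarith)) hq, expUtil_mix]
    nlinarith
  · rw [h.strictPref_iff hq (hp.mix hr (by linarith) (by linarith)), expUtil_mix]
    nlinarith

theorem Represents.rel_single_iff [DecidableEq Z] (h : Represents R u) (i j : Z) :
    R (Pi.single i 1) (Pi.single j 1) ↔ u j ≤ u i := by
  rw [h _ _ (.single i) (.single j), expUtil_single, expUtil_single]

theorem Represents.le_iff_le {u' : Z → ℝ} (h : Represents R u) (h' : Represents R u')
    (i j : Z) : u i ≤ u j ↔ u' i ≤ u' j := by
  classical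
  rw [← h.rel_single_iff, h'.rel_single_iff]

theorem Represents.collinear_of_le {u' : Z → ℝ} (h : Represents R u) (h' : Represents R u')
    {i j k : Z} (hij : u i ≤ u j) (hjk : u j ≤ u k) (hik : u i < u k) :
    (u' j - u' i) * (u k - u i) = (u j - u i) * (u' k - u' i) := by
  classical
  obtain ⟨t, ht⟩ : ∃ t, t = (u j - u i) / (u k - u i) := ⟨_, rfl⟩
  have hpos : 0 < u k - u i := by linarith
  have ht0 : 0 ≤ t := ht ▸ div_nonneg (by linarith) hpos.le
  have ht1 : t ≤ 1 := by rw [ht, div_le_one hpos]; linarith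
  have hmul : t * (u k - u i) = u j - u i := by rw [ht]; field_simp
  have hm := (IsLottery.single k).mix (IsLottery.single i) ht0 ht1
  have h₁ := (h' _ _ (.single j) hm).1 ((h _ _ (.single j) hm).2 (by
    rw [expUtil_mix]; simp only [expUtil_single]; linarith))
  have h₂ := (h' _ _ hm (.single j)).1 ((h _ _ hm (.single j)).2 (by
    rw [expUtil_mix]; simp only [expUtil_single]; linarith))
  rw [expUtil_mix] at h₁ h₂
  simp only [expUtil_single] at h₁ h₂
  have heq : u' j - u' i = t * (u' k - u' i) := by linarith
  rw [heq, ← hmul]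
  ring

/-- Expected utility representations are unique up to a positive affine transformation. -/
theorem Represents.exists_affine {u' : Z → ℝ} (h : Represents R u) (h' : Represents R u') :
    ∃ a b : ℝ, 0 < a ∧ ∀ z, u' z = a * u z + b := by
  by_cases hc : ∃ i k, u i < u k
  · obtain ⟨i, k, hik⟩ := hc
    have hik' : u' i < u' k := by
      rw [← not_le, ← h.le_iff_le h', not_le]; exact hik
    have hpos : 0 < u k - u i := by linarith
    refine ⟨(u' k - u' i) / (u k - u i), u' i - (u' k - u' i) / (u k - u i) * u i,
      div_pos (by linarith) hpos, fun z => ?_⟩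
    have key : (u' z - u' i) * (u k - u i) = (u z - u i) * (u' k - u' i) := by
      rcases le_total (u z) (u i) with hz | hz
      · linarith [h.collinear_of_le h' hz hik.le (by linarith)]
      · rcases le_total (u z) (u k) with hz' | hz'
        · exact h.collinear_of_le h' hz hz' hik
        · linarith [h.collinear_of_le h' hik.le hz' (by linarith)]
    field_simp
    linarith
  · push Not at hc
    rcases isEmpty_or_nonempty Z with hZ | ⟨⟨w⟩⟩
    · exact ⟨1, 0, one_pos, fun z => hZ.elim z⟩
    · refine ⟨1, u' w - u w, one_pos, fun z => ?_⟩
      have h₁ : u z = u w := le_antisymm (hc _ _) (hc _ _)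
      have h₂ : u' z = u' w :=
        le_antisymm ((h.le_iff_le h' _ _).1 (hc _ _)) ((h.le_iff_le h' _ _).1 (hc _ _))
      rw [h₁, h₂]; ring

end Representation

section VonNeumannMorgenstern

variable {Z : Type*} [Fintype Z] {R : (Z → ℝ) → (Z → ℝ) → Prop}

theorem CompleteAx.refl (hC : CompleteAx R) {p : Z → ℝ} (hp : IsLottery p) : R p p :=
  (hC p p hp hp).elim id id

theorem CompleteAx.strictPref (hC : CompleteAx R) {p q : Z → ℝ}
    (hp : IsLottery p) (hq : IsLottery q) (h : ¬ R q p) : StrictPref R p q :=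
  ⟨(hC p q hp hq).resolve_right h, h⟩

theorem StrictPref.trans_rel (hT : TransitiveAx R) {p q r : Z → ℝ}
    (hp : IsLottery p) (hq : IsLottery q) (hr : IsLottery r)
    (h : StrictPref R p q) (h' : R q r) : StrictPref R p r :=
  ⟨hT p q r hp hq hr h.1 h', fun hrp => h.2 (hT q r p hq hr hp h' hrp)⟩

theorem TransitiveAx.rel_trans_strictPref (hT : TransitiveAx R) {p q r : Z → ℝ}
    (hp : IsLottery p) (hq : IsLottery q) (hr : IsLottery r)
    (h : R p q) (h' : StrictPref R q r) : StrictPref R p r :=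
  ⟨hT p q r hp hq hr h h'.1, fun hrp => h'.2 (hT r p q hr hp hq hrp h)⟩

theorem mix_self {Z : Type*} (α : ℝ) (p : Z → ℝ) : mix α p p = p := by
  ext z; simp only [mix]; ring

theorem mix_zero {Z : Type*} (p q : Z → ℝ) : mix 0 p q = q := by
  ext z; simp [mix]

theorem mix_one {Z : Type*} (p q : Z → ℝ) : mix 1 p q = p := by
  ext z; simp [mix]

theorem IndependenceAx.strictPref_mix_mix (hI : IndependenceAx R) {p q : Z → ℝ}
    (hp : IsLottery p) (hq : IsLottery q) (hpq : StrictPref R p q) {a b : ℝ}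
    (hb : 0 ≤ b) (hba : b < a) (ha : a ≤ 1) : StrictPref R (mix a p q) (mix b p q) := by
  have ha0 : 0 < a := by linarith
  have hs := hI p q q hp hq hq a ha0 ha hpq
  rw [mix_self] at hs
  have hl := hp.mix hq ha0.le ha
  have hlt : b / a < 1 := (div_lt_one ha0).2 hba
  have hnn : 0 ≤ b / a := div_nonneg hb ha0.le
  have := hI _ q _ hl hq hl (1 - b / a) (by linarith) (by linarith) hs
  rw [mix_self] at this
  convert this using 1
  ext z
  simp only [mix]
  field_simp
  ring

theorem rel_mix_iff_le (hC : CompleteAx R) (hI : IndependenceAx R) {p q : Z → ℝ}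
    (hp : IsLottery p) (hq : IsLottery q) (hpq : StrictPref R p q) {a b : ℝ}
    (ha0 : 0 ≤ a) (ha : a ≤ 1) (hb0 : 0 ≤ b) (hb : b ≤ 1) :
    R (mix a p q) (mix b p q) ↔ b ≤ a := by
  refine ⟨fun h => ?_, fun h => ?_⟩
  · by_contra! hlt
    exact (hI.strictPref_mix_mix hp hq hpq ha0 hlt hb).2 h
  · rcases h.eq_or_lt with rfl | hlt
    · exact hC.refl (hp.mix hq ha0 ha)
    · exact (hI.strictPref_mix_mix hp hq hpq hb0 hlt ha).1

/-- A lottery ranked between two others is indifferent to a mixture of them. -/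
theorem exists_mix_indifferent (hC : CompleteAx R) (hT : TransitiveAx R)
    (hI : IndependenceAx R) (hK : ContinuityAx R) {p q r : Z → ℝ}
    (hp : IsLottery p) (hq : IsLottery q) (hr : IsLottery r)
    (hpq : R p q) (hqr : R q r) (hpr : StrictPref R p r) :
    ∃ α : ℝ, 0 ≤ α ∧ α ≤ 1 ∧ R q (mix α p r) ∧ R (mix α p r) q := by
  by_cases hqp : R q p
  · exact ⟨1, zero_le_one, le_rfl, by rwa [mix_one], by rwa [mix_one]⟩
  by_cases hrq : R r q
  · exact ⟨0, le_rfl, zero_le_one, by rwa [mix_zero], by rwa [mix_zero]⟩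
  let S : Set ℝ := {a | 0 ≤ a ∧ a ≤ 1 ∧ R q (mix a p r)}
  have h0S : (0 : ℝ) ∈ S := ⟨le_rfl, zero_le_one, by rwa [mix_zero]⟩
  have hbdd : BddAbove S := ⟨1, fun a ha => ha.2.1⟩
  have hα0 : 0 ≤ sSup S := le_csSup hbdd h0S
  have hα1 : sSup S ≤ 1 := csSup_le ⟨0, h0S⟩ fun a ha => ha.2.1
  have hm := hp.mix hr hα0 hα1
  refine ⟨sSup S, hα0, hα1, ?_, ?_⟩
  · by_contra hn
    obtain ⟨γ, -, hγ0, hγ1, -, -, hγ, -⟩ :=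
      hK _ q r hm hq hr (hC.strictPref hm hq hn) ⟨hqr, hrq⟩
    have heq : mix γ (mix (sSup S) p r) r = mix (γ * sSup S) p r := by
      ext z; simp only [mix]; ring
    rw [heq] at hγ
    have hpos : 0 < sSup S := by
      refine hα0.lt_of_ne fun h => hn ?_
      rw [← h, mix_zero]
      exact hqr
    obtain ⟨s, hs, hlt⟩ := exists_lt_of_lt_csSup ⟨0, h0S⟩
      (show γ * sSup S < sSup S by nlinarith)
    have hγα : 0 ≤ γ * sSup S := by positivity
    have hγα1 : γ * sSup S ≤ 1 := by nlinarith
    exact hγ.2 (hT _ _ _ hq (hp.mix hr hs.1 hs.2.1) (hp.mix hr hγα hγα1) hs.2.2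
      (hI.strictPref_mix_mix hp hr hpr hγα hlt hs.2.1).1)
  · by_contra hn
    obtain ⟨-, β, -, -, hβ0, hβ1, -, hβ⟩ :=
      hK p q _ hp hq hm ⟨hpq, hqp⟩ (hC.strictPref hq hm hn)
    have heq : mix β p (mix (sSup S) p r) = mix (β + (1 - β) * sSup S) p r := by
      ext z; simp only [mix]; ring
    rw [heq] at hβ
    have hlt : sSup S < 1 := by
      refine hα1.lt_of_ne fun h => hn ?_
      rw [h, mix_one]
      exact hpq
    have hmem : β + (1 - β) * sSup S ∈ S := ⟨by nlinarith, by nlinarith, hβ.1⟩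
    have := le_csSup hbdd hmem
    nlinarith

/-- Indifference is preserved by mixing with a third lottery. -/
theorem rel_mix_of_indifferent (hC : CompleteAx R) (hT : TransitiveAx R)
    (hI : IndependenceAx R) (hK : ContinuityAx R) {p q r : Z → ℝ}
    (hp : IsLottery p) (hq : IsLottery q) (hr : IsLottery r)
    (hpq : R p q) (hqp : R q p) {a : ℝ} (ha0 : 0 ≤ a) (ha1 : a ≤ 1) :
    R (mix a p r) (mix a q r) := by
  rcases ha0.eq_or_lt with rfl | ha
  · rw [mix_zero, mix_zero]; exact hC.refl hr
  have hpr := hp.mix hr ha0 ha1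
  have hqr := hq.mix hr ha0 ha1
  by_contra hn
  have hst := hC.strictPref hqr hpr hn
  by_cases hs : ∃ s, IsLottery s ∧ StrictPref R s q
  · obtain ⟨s, hs, hsq⟩ := hs
    have hsr := hs.mix hr ha0 ha1
    obtain ⟨-, β, -, -, hβ0, hβ1, -, hβ⟩ :=
      hK _ _ _ hsr hqr hpr (hI _ _ _ hs hq hr a ha ha1 hsq) hst
    have hsp := hsq.trans_rel hT hs hq hp hqp
    have hb := hI _ _ _ hs hp hp β hβ0 hβ1.le hsp
    rw [mix_self] at hb
    have hsβ := hs.mix hp hβ0.le hβ1.le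
    have hc := hI _ _ _ hsβ hq hr a ha ha1 (hb.trans_rel hT hsβ hp hq hpq)
    refine hβ.2 ?_
    convert hc.1 using 1
    ext z; simp only [mix]; ring
  by_cases hs' : ∃ s, IsLottery s ∧ StrictPref R p s
  · obtain ⟨s, hs, hps⟩ := hs'
    have hsr := hs.mix hr ha0 ha1
    obtain ⟨α, -, hα0, hα1, -, -, hα, -⟩ :=
      hK _ _ _ hqr hpr hsr hst (hI _ _ _ hp hs hr a ha ha1 hps)
    have hqs := hT.rel_trans_strictPref hq hp hs hqp hps
    have hb := hI _ _ _ hq hs hq (1 - α) (by linarith) (by linarith) hqs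
    rw [mix_self] at hb
    have hsα := hs.mix hq (sub_nonneg.2 hα1.le) (by linarith : 1 - α ≤ 1)
    have hc := hI _ _ _ hp hsα hr a ha ha1 (hT.rel_trans_strictPref hp hq hsα hpq hb)
    refine hα.2 ?_
    convert hc.1 using 1
    ext z; simp only [mix]; ring
  push Not at hs hs'
  have h₁ : R q (mix a q r) := by
    by_contra h
    exact hs _ hqr (hC.strictPref hqr hq h)
  have h₂ : R (mix a p r) p := by
    by_contra h
    exact hs' _ hpr (hC.strictPref hp hpr h)
  exact hn (hT _ _ _ hpr hp hqr h₂ (hT _ _ _ hp hq hqr hpq h₁))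

theorem exists_sum_update_eq_mix {ι : Type*} [Fintype ι] [DecidableEq ι] {p : ι → ℝ}
    (hp : IsLottery p) {f : ι → Z → ℝ} (hf : ∀ i, IsLottery (f i)) (j : ι) :
    ∃ r : Z → ℝ, IsLottery r ∧
      ∀ g : Z → ℝ, ∑ i, p i • Function.update f j g i = mix (p j) g r := by
  have hsum : p j + ∑ i ∈ Finset.univ.erase j, p i = 1 := by
    rw [Finset.add_sum_erase _ _ (Finset.mem_univ j)]; exact hp.2
  have hsplit : ∀ g : Z → ℝ, ∑ i, p i • Function.update f j g i =
      p j • g + ∑ i ∈ Finset.univ.erase j, p i • f i := by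
    intro g
    rw [← Finset.add_sum_erase _ _ (Finset.mem_univ j), Function.update_self]
    congr 1
    refine Finset.sum_congr rfl fun i hi => ?_
    rw [Function.update_of_ne (Finset.ne_of_mem_erase hi)]
  have hnn : 0 ≤ ∑ i ∈ Finset.univ.erase j, p i := Finset.sum_nonneg fun i _ => hp.1 i
  rcases hnn.eq_or_lt with h0 | hpos
  · refine ⟨f j, hf j, fun g => ?_⟩
    have hz := (Finset.sum_eq_zero_iff_of_nonneg fun i _ => hp.1 i).1 h0.symm
    have hj : p j = 1 := by linarith
    rw [hsplit, Finset.sum_eq_zero fun i hi => by rw [hz i hi, zero_smul], hj, mix_one]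
    simp
  · have hne : 1 - p j ≠ 0 := by linarith
    have hval : ∀ z, (∑ i ∈ Finset.univ.erase j, p i • f i) z =
        ∑ i ∈ Finset.univ.erase j, p i * f i z := fun z => by
      simp [Finset.sum_apply]
    refine ⟨(1 - p j)⁻¹ • ∑ i ∈ Finset.univ.erase j, p i • f i, ⟨fun z => ?_, ?_⟩,
      fun g => ?_⟩
    · rw [Pi.smul_apply, hval]
      exact mul_nonneg (inv_nonneg.2 (by linarith))
        (Finset.sum_nonneg fun i _ => mul_nonneg (hp.1 i) ((hf i).1 z))
    · simp only [Pi.smul_apply, hval, smul_eq_mul, ← Finset.mul_sum]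
      rw [Finset.sum_comm]
      simp only [← Finset.mul_sum, (hf _).2, mul_one]
      rw [inv_mul_eq_one₀ hne]
      linarith
    · rw [hsplit]
      ext z
      simp [mix, mul_inv_cancel_left₀ hne]

/-- Compound lotteries with indifferent components are indifferent. -/
theorem rel_sum_smul_of_indifferent (hC : CompleteAx R) (hT : TransitiveAx R)
    (hI : IndependenceAx R) (hK : ContinuityAx R) {ι : Type*} [Fintype ι]
    {p : ι → ℝ} (hp : IsLottery p) {f g : ι → Z → ℝ}
    (hf : ∀ i, IsLottery (f i)) (hg : ∀ i, IsLottery (g i))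
    (hfg : ∀ i, R (f i) (g i)) (hgf : ∀ i, R (g i) (f i)) :
    R (∑ i, p i • f i) (∑ i, p i • g i) := by
  classical
  have hl : ∀ (S : Finset ι) i, IsLottery (S.piecewise g f i) := fun S i => by
    by_cases hi : i ∈ S <;> simp [hi, hf, hg]
  suffices h : ∀ S : Finset ι, R (∑ i, p i • f i) (∑ i, p i • S.piecewise g f i) by
    simpa using h Finset.univ
  intro S
  induction S using Finset.induction_on with
  | empty => simpa using hC.refl (hp.sum_smul hf)
  | insert j S hj ih =>
    refine hT _ _ _ (hp.sum_smul hf) (hp.sum_smul (hl _)) (hp.sum_smul (hl _)) ih ?_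
    obtain ⟨r, hr, heq⟩ := exists_sum_update_eq_mix hp (hl S) j
    have h₁ := heq (f j)
    have hfj : f j = S.piecewise g f j := by simp [hj]
    rw [Function.update_eq_self_iff.2 hfj] at h₁
    rw [Finset.piecewise_insert, heq, h₁]
    have hj1 : p j ≤ 1 := hp.2 ▸ Finset.single_le_sum (fun i _ => hp.1 i) (Finset.mem_univ j)
    exact rel_mix_of_indifferent hC hT hI hK (hf j) (hg j) hr (hfg j) (hgf j) (hp.1 j) hj1

theorem sum_smul_single {Z : Type*} [Fintype Z] [DecidableEq Z] (p : Z → ℝ) :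
    ∑ z, p z • (Pi.single z (1 : ℝ) : Z → ℝ) = p := by
  ext w
  simp [Finset.sum_apply, Pi.single_apply]

/-- The von Neumann–Morgenstern expected utility theorem over finitely many outcomes. -/
theorem exists_represents [Nonempty Z] (hC : CompleteAx R) (hT : TransitiveAx R)
    (hI : IndependenceAx R) (hK : ContinuityAx R) : ∃ u : Z → ℝ, Represents R u := by
  classical
  let δ : Z → Z → ℝ := fun z => Pi.single z 1
  have hδ : ∀ z, IsLottery (δ z) := fun z => .single z
  have : IsTrans Z fun i j => R (δ i) (δ j) :=
    ⟨fun i j k => hT _ _ _ (hδ i) (hδ j) (hδ k)⟩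
  have : IsTrans Z fun i j => R (δ j) (δ i) :=
    ⟨fun i j k hij hjk => hT _ _ _ (hδ k) (hδ j) (hδ i) hjk hij⟩
  obtain ⟨w, hw⟩ : ∃ w, ∀ z, R (δ z) (δ w) := by
    refine Directed.finite_le (r := fun i j => R (δ i) (δ j)) (f := id) (fun i j => ?_) id
    rcases hC _ _ (hδ i) (hδ j) with h | h
    · exact ⟨j, h, hC.refl (hδ j)⟩
    · exact ⟨i, hC.refl (hδ i), h⟩
  obtain ⟨b, hb⟩ : ∃ b, ∀ z, R (δ b) (δ z) := by
    refine Directed.finite_le (r := fun i j => R (δ j) (δ i)) (f := id) (fun i j => ?_) id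
    rcases hC _ _ (hδ i) (hδ j) with h | h
    · exact ⟨i, hC.refl (hδ i), h⟩
    · exact ⟨j, h, hC.refl (hδ j)⟩
  have hsum : ∀ {p : Z → ℝ}, IsLottery p → ∀ {g : Z → Z → ℝ}, (∀ z, IsLottery (g z)) →
      (∀ z, R (δ z) (g z)) → (∀ z, R (g z) (δ z)) →
      R p (∑ z, p z • g z) ∧ R (∑ z, p z • g z) p := by
    intro p hp g hg h₁ h₂
    have h₃ := rel_sum_smul_of_indifferent hC hT hI hK hp hδ hg h₁ h₂
    have h₄ := rel_sum_smul_of_indifferent hC hT hI hK hp hg hδ h₂ h₁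
    rw [sum_smul_single] at h₃ h₄
    exact ⟨h₃, h₄⟩
  by_cases hwb : R (δ w) (δ b)
  · refine ⟨0, fun p q hp hq => ?_⟩
    simp only [expUtil, Pi.zero_apply, zero_mul, ge_iff_le, le_refl, iff_true]
    have h : ∀ {p : Z → ℝ}, IsLottery p → R p (δ b) ∧ R (δ b) p := by
      intro p hp
      have := hsum hp (fun _ => hδ b) (fun z => hT _ _ _ (hδ z) (hδ w) (hδ b) (hw z) hwb) hb
      rwa [← Finset.sum_smul, hp.2, one_smul] at this
    exact hT _ _ _ hp (hδ b) hq (h hp).1 (h hq).2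
  · have hbw : StrictPref R (δ b) (δ w) := ⟨hb w, hwb⟩
    choose u hu0 hu1 hu hu' using fun z =>
      exists_mix_indifferent hC hT hI hK (hδ b) (hδ z) (hδ w) (hb z) (hw z) hbw
    have hE0 : ∀ {p : Z → ℝ}, IsLottery p → 0 ≤ expUtil u p := fun hp =>
      Finset.sum_nonneg fun z _ => mul_nonneg (hu0 z) (hp.1 z)
    have hE1 : ∀ {p : Z → ℝ}, IsLottery p → expUtil u p ≤ 1 := fun hp =>
      hp.2 ▸ Finset.sum_le_sum fun z _ => mul_le_of_le_one_left (hp.1 z) (hu1 z)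
    have hmix : ∀ {p : Z → ℝ}, IsLottery p →
        ∑ z, p z • mix (u z) (δ b) (δ w) = mix (expUtil u p) (δ b) (δ w) := by
      intro p hp
      ext x
      have : ∀ z, p z * (u z * δ b x + (1 - u z) * δ w x) =
          u z * p z * (δ b x - δ w x) + p z * δ w x := fun z => by ring
      simp only [Finset.sum_apply, Pi.smul_apply, smul_eq_mul, mix, this,
        Finset.sum_add_distrib, ← Finset.sum_mul, hp.2, expUtil]
      ring
    have hind : ∀ {p : Z → ℝ}, IsLottery p →
        R p (mix (expUtil u p) (δ b) (δ w)) ∧ R (mix (expUtil u p) (δ b) (δ w)) p := by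
      intro p hp
      rw [← hmix hp]
      exact hsum hp (fun z => (hδ b).mix (hδ w) (hu0 z) (hu1 z)) hu hu'
    have hl : ∀ {p : Z → ℝ}, IsLottery p → IsLottery (mix (expUtil u p) (δ b) (δ w)) :=
      fun hp => (hδ b).mix (hδ w) (hE0 hp) (hE1 hp)
    refine ⟨u, fun p q hp hq => ?_⟩
    rw [ge_iff_le, ← rel_mix_iff_le hC hI (hδ b) (hδ w) hbw (hE0 hp) (hE1 hp) (hE0 hq) (hE1 hq)]
    exact ⟨fun h => hT _ _ _ (hl hp) hp (hl hq) (hind hp).2 (hT _ _ _ hp hq (hl hq) h (hind hq).1),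
      fun h => hT _ _ _ hp (hl hp) hq (hind hp).1 (hT _ _ _ (hl hp) (hl hq) hq h (hind hq).2)⟩

end VonNeumannMorgenstern

theorem IsLottery.eq_zero_of_probDec_eq_one {D Y X : Type*} [Fintype D] [DecidableEq D]
    [Fintype Y] [Fintype X] {p : D × (D → Y) × X → ℝ} (hp : IsLottery p)
    {d : D} (hd : probDec p d = 1) {z : D × (D → Y) × X} (hz : z.1 ≠ d) : p z = 0 := by
  have h : ∑ z, (p z - if z.1 = d then p z else 0) = 0 := by
    rw [Finset.sum_sub_distrib, hp.2]
    exact sub_eq_zero.2 hd.symm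
  have hnn : ∀ z ∈ Finset.univ, 0 ≤ p z - if z.1 = d then p z else 0 := fun z _ => by
    split_ifs
    · simp
    · simpa using hp.1 z
  simpa [hz] using (Finset.sum_eq_zero_iff_of_nonneg hnn).1 h z (Finset.mem_univ z)

theorem expUtil_outcome_eq_sum_probOut {D Y X : Type*} [Fintype D] [DecidableEq D]
    [Fintype Y] [DecidableEq Y] [Fintype X] (u : Y → ℝ) {p : D × (D → Y) × X → ℝ}
    (hp : IsLottery p) {d : D} (hd : probDec p d = 1) :
    expUtil (fun z => u (z.2.1 z.1)) p = ∑ v, u v * probOut p d v := by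
  simp only [probOut, Finset.mul_sum]
  rw [Finset.sum_comm, expUtil]
  refine Finset.sum_congr rfl fun z _ => ?_
  by_cases hz : z.1 = d
  · simp [hz]
  · simp [hp.eq_zero_of_probDec_eq_one hd hz]

section OutcomeUtility

variable {D Y X : Type*} [Fintype D] [DecidableEq D] [Fintype Y] [DecidableEq Y]
  [Fintype X] [DecidableEq X]

theorem probDec_single (z : D × (D → Y) × X) : probDec (Pi.single z 1) z.1 = 1 := by
  rw [probDec, Finset.sum_eq_single z] <;> simp +contextual

theorem probCov_single (z : D × (D → Y) × X) : probCov (Pi.single z 1) z.2.2 = 1 := by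
  rw [probCov, Finset.sum_eq_single z] <;> simp +contextual

theorem probOut_single (z : D × (D → Y) × X) (k : D) (v : Y) :
    probOut (Pi.single z 1) k v = if z.2.1 k = v then 1 else 0 := by
  rw [probOut, Finset.sum_eq_single z] <;> simp +contextual

theorem Represents.realizedOutcomeSufficiency
    {R : (D × (D → Y) × X → ℝ) → (D × (D → Y) × X → ℝ) → Prop} {u : Y → ℝ}
    (h : Represents R fun z => u (z.2.1 z.1)) : RealizedOutcomeSufficiency R := by
  intro p q hp hq d d' x x' hpd _ hqd _ hv
  have heq : expUtil (fun z : D × (D → Y) × X => u (z.2.1 z.1)) p =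
      expUtil (fun z => u (z.2.1 z.1)) q := by
    rw [expUtil_outcome_eq_sum_probOut u hp hpd, expUtil_outcome_eq_sum_probOut u hq hqd]
    simp only [hv]
  exact ⟨(h p q hp hq).2 heq.ge, (h q p hq hp).2 heq.le⟩

theorem RealizedOutcomeSufficiency.eq_of_represents
    {R : (D × (D → Y) × X → ℝ) → (D × (D → Y) × X → ℝ) → Prop}
    (hS : RealizedOutcomeSufficiency R) {U : D × (D → Y) × X → ℝ} (hU : Represents R U)
    {z w : D × (D → Y) × X} (hzw : z.2.1 z.1 = w.2.1 w.1) : U z = U w := by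
  obtain ⟨h₁, h₂⟩ := hS _ _ (.single z) (.single w) z.1 w.1 z.2.2 w.2.2
    (probDec_single z) (probCov_single z) (probDec_single w) (probCov_single w)
    (fun v => by rw [probOut_single, probOut_single, hzw])
  exact le_antisymm ((hU.rel_single_iff w z).1 h₂) ((hU.rel_single_iff z w).1 h₁)

end OutcomeUtility

/-- Preferences satisfying the vNM axioms together with Realized Outcome Sufficiency are
exactly those represented by an outcome utility `ũ(d, y, x) = u(y d)`; moreover the
representing function is unique up to a positive affine transformation. -/
theorem outcome_utility_representation
    (D Y X : Type*) [Fintype D] [DecidableEq D] [Nonempty D]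
    [Fintype Y] [DecidableEq Y] [Nonempty Y]
    [Fintype X] [DecidableEq X] [Nonempty X]
    (R : (D × (D → Y) × X → ℝ) → (D × (D → Y) × X → ℝ) → Prop) :
    ((CompleteAx R ∧ TransitiveAx R ∧ IndependenceAx R ∧ ContinuityAx R ∧
        RealizedOutcomeSufficiency R) ↔
      ∃ u : Y → ℝ, Represents R (fun z => u (z.2.1 z.1))) ∧
    (∀ u u' : Y → ℝ,
      Represents R (fun z => u (z.2.1 z.1)) →
      Represents R (fun z => u' (z.2.1 z.1)) →
      ∃ a b : ℝ, 0 < a ∧ ∀ v : Y, u' v = a * u v + b) := by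
  obtain ⟨d₀⟩ := ‹Nonempty D›
  obtain ⟨x₀⟩ := ‹Nonempty X›
  refine ⟨⟨?_, ?_⟩, ?_⟩
  · rintro ⟨hC, hT, hI, hK, hS⟩
    have : Nonempty (D × (D → Y) × X) := ⟨(d₀, fun _ => Classical.arbitrary Y, x₀)⟩
    obtain ⟨U, hU⟩ := exists_represents hC hT hI hK
    refine ⟨fun v => U (d₀, fun _ => v, x₀), ?_⟩
    convert hU using 2 with z
    exact hS.eq_of_represents hU rfl
  · rintro ⟨u, hu⟩
    exact ⟨hu.completeAx, hu.transitiveAx, hu.independenceAx, hu.continuityAx,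
      hu.realizedOutcomeSufficiency⟩
  · intro u u' hu hu'
    obtain ⟨a, b, ha, hab⟩ := hu.exists_affine hu'
    exact ⟨a, b, ha, fun v => hab (d₀, fun _ => v, x₀)⟩
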